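/- Soundness of the frame rule: for any command C and SL propositions P, Q, R, if the Hoare triple {P} C {Q} holds then the Hoare triple {P * R} C {Q * R} holds (no side conditions are required). -/

import Mathlib

open scoped Classical

noncomputable section

namespace QSL

/-! ## Resources -/

/-- Vectors over the Hilbert space with orthonormal basis indexed by `Q → {0,1}`. -/
def Vec {Qubit : Type} (Q : Finset Qubit) : Type := ({ q // q ∈ Q } → Bool) → ℂ

/-- A quantum state: a finite set of qubits together with a vector over them. -/
def QState (Qubit : Type) : Type := Σ Q : Finset Qubit, Vec Q

/-- A store: a partial function from variables to values. -/
def Store (Var Val : Type) : Type := Var → Option Val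

/-- A resource: a quantum state together with a store. -/
def Res (Qubit Var Val : Type) : Type := QState Qubit × Store Var Val

variable {Qubit Var Val : Type}

/-- Tensor product of vectors over disjoint qubit sets. -/
def tensorVec {Q Q' : Finset Qubit} (v : Vec Q) (w : Vec Q') : Vec (Q ∪ Q') := fun f =>
  v (fun q => f ⟨q.1, Finset.mem_union_left _ q.2⟩) *
  w (fun q => f ⟨q.1, Finset.mem_union_right _ q.2⟩)

/-- Transport of a vector along an equality of qubit sets. -/
def castVec {Q Q' : Finset Qubit} (h : Q = Q') (v : Vec Q) : Vec Q' := h ▸ v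

/-- The empty quantum state with scalar 1. -/
def unitQ : QState Qubit := ⟨(∅ : Finset Qubit), fun _ => 1⟩

/-- The unit resource: empty qubit set with scalar 1 and the empty store. -/
def unitRes : Res Qubit Var Val := (unitQ, fun _ => none)

/-- Partial product of resources: defined iff the qubit sets are disjoint and
the store domains are disjoint; takes the union of qubit sets, tensor product of
vectors, and union of stores. -/
def rmul (a b : Res Qubit Var Val) : Option (Res Qubit Var Val) :=
  if h : Disjoint a.1.1 b.1.1 ∧ ∀ x, a.2 x = none ∨ b.2 x = none then
    some (⟨a.1.1 ∪ b.1.1, tensorVec a.1.2 b.1.2⟩, fun x => a.2 x <|> b.2 x)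
  else none

/-- Partial sum of resources: defined iff the two resources have the same
qubit set and the same store; adds the vectors. -/
def radd (a b : Res Qubit Var Val) : Option (Res Qubit Var Val) :=
  if h : a.1.1 = b.1.1 ∧ a.2 = b.2 then
    some (⟨b.1.1, fun f => castVec h.1 a.1.2 f + b.1.2 f⟩, b.2)
  else none

/-- Incompatibility of resources: some variable lies in both store domains and
the stores disagree on it. -/
def incompat (a b : Res Qubit Var Val) : Prop :=
  ∃ x u u', a.2 x = some u ∧ b.2 x = some u' ∧ u ≠ u'

/-! ## Multisets (possibly infinite, as families up to bijective reindexing) -/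

/-- An indexed family representing a multiset. -/
structure PreMSet (A : Type) : Type 1 where
  idx : Type
  val : idx → A

/-- Equivalence of indexed families by bijective reindexing. -/
def msetEquiv {A : Type} (f g : PreMSet A) : Prop :=
  ∃ e : f.idx ≃ g.idx, ∀ i, f.val i = g.val (e i)

theorem msetEquiv_refl {A : Type} (f : PreMSet A) : msetEquiv f f :=
  ⟨Equiv.refl _, fun _ => rfl⟩

theorem msetEquiv_symm {A : Type} {f g : PreMSet A} : msetEquiv f g → msetEquiv g f
  | ⟨e, h⟩ => ⟨e.symm, fun i => by rw [h (e.symm i), Equiv.apply_symm_apply]⟩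

theorem msetEquiv_trans {A : Type} {f g k : PreMSet A} :
    msetEquiv f g → msetEquiv g k → msetEquiv f k
  | ⟨e, h⟩, ⟨e', h'⟩ => ⟨e.trans e', fun i => (h i).trans (h' (e i))⟩

instance msetSetoid (A : Type) : Setoid (PreMSet A) :=
  ⟨msetEquiv, ⟨msetEquiv_refl, msetEquiv_symm, msetEquiv_trans⟩⟩

/-- Multisets over `A`: families up to bijective reindexing. -/
def MSet (A : Type) : Type 1 := Quotient (msetSetoid A)

def MSet.mk {A : Type} (I : Type) (f : I → A) : MSet A :=
  Quotient.mk (msetSetoid A) ⟨I, f⟩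

/-- A canonical representative family of a multiset. -/
def MSet.out {A : Type} (m : MSet A) : PreMSet A := Quotient.out m

/-- `a` is an occurrence of the multiset `m`. -/
def MSet.MemM {A : Type} (a : A) (m : MSet A) : Prop := ∃ i, m.out.val i = a

def MSet.map {A B : Type} (f : A → B) (m : MSet A) : MSet B :=
  MSet.mk m.out.idx (fun i => f (m.out.val i))

/-- Sum (disjoint union) of two multisets. -/
def MSet.uplus {A : Type} (m m' : MSet A) : MSet A :=
  MSet.mk (m.out.idx ⊕ m'.out.idx) (Sum.elim m.out.val m'.out.val)

/-- Indexed sum (disjoint union) of a family of multisets. -/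
def MSet.biguplus {A : Type} (I : Type) (f : I → MSet A) : MSet A :=
  MSet.mk (Σ x : I, (f x).out.idx) (fun p => (f p.1).out.val p.2)


/-- Partial product of multisets of resources: an occurrence `a·b` for every
pair of occurrences, defined iff all these resource products are defined. -/
def mprodM (m m' : MSet (Res Qubit Var Val)) : Option (MSet (Res Qubit Var Val)) :=
  if h : ∀ (i : m.out.idx) (j : m'.out.idx), (rmul (m.out.val i) (m'.out.val j)).isSome then
    some (MSet.mk (m.out.idx × m'.out.idx)
      (fun p => (rmul (m.out.val p.1) (m'.out.val p.2)).get (h p.1 p.2)))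
  else none

/-- Sum of the two projections of a multiset of pairs of resources (the
multiset of pairs plays the role of a multiset bijection between its two
projections): defined iff all the componentwise resource sums are defined. -/
def msumr (r : MSet (Res Qubit Var Val × Res Qubit Var Val)) :
    Option (MSet (Res Qubit Var Val)) :=
  if h : ∀ i, (radd (r.out.val i).1 (r.out.val i).2).isSome then
    some (MSet.mk r.out.idx (fun i => (radd (r.out.val i).1 (r.out.val i).2).get (h i)))
  else none

/-! ## SL propositions -/

/-- An SL proposition: a set of multisets of resources. -/
abbrev SLProp (Qubit Var Val : Type) : Type 1 := Set (MSet (Res Qubit Var Val))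


/-- Entailment of SL propositions: set inclusion. -/
def entails (P Q : SLProp Qubit Var Val) : Prop := P ⊆ Q

/-- Separating conjunction. -/
def star (P Q : SLProp Qubit Var Val) : SLProp Qubit Var Val :=
  { m | ∃ mp ∈ P, ∃ mq ∈ Q, mprodM mp mq = some m }

/-- Sum of SL propositions: all defined sums `m +_r m'` over `m ∈ P`, `m' ∈ Q`
and multiset bijections `r` between `m` and `m'`. -/
def propSum (P Q : SLProp Qubit Var Val) : SLProp Qubit Var Val :=
  { m | ∃ r : MSet (Res Qubit Var Val × Res Qubit Var Val),
      MSet.map Prod.fst r ∈ P ∧ MSet.map Prod.snd r ∈ Q ∧ msumr r = some m }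

/-- Indexed bare mixing. -/
def bigMix (I : Type) (P : I → SLProp Qubit Var Val) : SLProp Qubit Var Val :=
  { m | ∃ f : I → MSet (Res Qubit Var Val), (∀ x, f x ∈ P x) ∧ m = MSet.biguplus I f }

/-- Binary bare mixing, the case of `bigMix` over a two-element index set. -/
def binMix (P Q : SLProp Qubit Var Val) : SLProp Qubit Var Val :=
  bigMix Bool (fun b => if b then Q else P)

/-- Precision: any two multisets in `P` are equal. -/
def precise (P : SLProp Qubit Var Val) : Prop := ∀ m ∈ P, ∀ m' ∈ P, m = m'

/-- Non-emptiness of behaviours: every multiset in `P` is nonempty. -/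
def nonnb (P : SLProp Qubit Var Val) : Prop := ∀ m ∈ P, Nonempty (MSet.out m).idx

/-- Unambiguity: any two occurrences at distinct indices are incompatible. -/
def unambig (P : SLProp Qubit Var Val) : Prop :=
  ∀ m ∈ P, ∀ i j : (MSet.out m).idx, i ≠ j → incompat (m.out.val i) (m.out.val j)

/-- Incompatibility of SL propositions: every occurrence of every `m ∈ P` is
incompatible with every occurrence of every `m' ∈ Q`. -/
def propIncompat (P Q : SLProp Qubit Var Val) : Prop :=
  ∀ m ∈ P, ∀ m' ∈ Q, ∀ (i : (MSet.out m).idx) (j : (MSet.out m').idx),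
    incompat (m.out.val i) (m'.out.val j)

/-- The singleton proposition of the one-element multiset of a resource. -/
def singletonProp (a : Res Qubit Var Val) : SLProp Qubit Var Val :=
  { m | m = MSet.mk PUnit (fun _ => a) }

/-- The points-to proposition `ι ↦ v`: empty quantum state (scalar 1) and the
store mapping only `ι` to `v`. -/
def varPoints (ι : Var) (v : Val) : SLProp Qubit Var Val :=
  singletonProp (unitQ, fun y => if y = ι then some v else none)

/-- Tagged mixing over an index set of values. -/
def taggedMix (ι : Var) (I : Set Val) (P : Val → SLProp Qubit Var Val) :
    SLProp Qubit Var Val :=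
  bigMix I (fun x => star (varPoints ι x.1) (P x.1))

/-! ## The programming language (values are natural numbers) -/

/-- Pure expressions: constants, variables, operations applied to subexpressions. -/
inductive Expr (Var : Type) : Type
  | const : ℕ → Expr Var
  | evar : Var → Expr Var
  | op : (n : ℕ) → ((Fin n → ℕ) → ℕ) → (Fin n → Expr Var) → Expr Var

/-- Evaluation of a pure expression in a store; undefined on variables outside
the store's domain. -/
def Expr.eval {Var : Type} (S : Store Var ℕ) : Expr Var → Option ℕ
  | .const n => some n
  | .evar x => S x
  | .op n f es =>
      if h : ∀ i, (Expr.eval S (es i)).isSome then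
        some (f (fun i => (Expr.eval S (es i)).get (h i)))
      else none

/-- A unitary operator on `n` qubits, as a matrix with orthonormal columns. -/
structure UnitaryOp (n : ℕ) : Type where
  mat : (Fin n → Bool) → (Fin n → Bool) → ℂ
  unitary : ∀ a b, (∑ c : Fin n → Bool, (starRingEnd ℂ) (mat c a) * mat c b) =
    if a = b then 1 else 0

/-- A measurement: a finite family of linear operators `M⁽ⁱ⁾` on `n` qubits
with `Σᵢ (M⁽ⁱ⁾)† M⁽ⁱ⁾ = I`. -/
structure MeasOp (k n : ℕ) : Type where
  ops : Fin k → (Fin n → Bool) → (Fin n → Bool) → ℂ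
  complete : ∀ a b,
    (∑ i : Fin k, ∑ c : Fin n → Bool, (starRingEnd ℂ) (ops i c a) * ops i c b) =
      if a = b then 1 else 0


/-- Apply an operator (given by its matrix) to the designated qubits of a
quantum state; defined iff the designated qubits are distinct and all present. -/
def applyOp {n : ℕ} (mat : (Fin n → Bool) → (Fin n → Bool) → ℂ) (qs : Fin n → Qubit)
    (ψ : QState Qubit) : Option (QState Qubit) :=
  if h : Function.Injective qs ∧ ∀ i, qs i ∈ ψ.1 then
    some ⟨ψ.1, fun g => ∑ b : Fin n → Bool,
      mat (fun i => g ⟨qs i, h.2 i⟩) b *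
      ψ.2 (fun q => if h' : ∃ i, qs i = q.1 then b h'.choose else g q)⟩
  else none

/-- Commands of the language. -/
inductive Cmd (Qubit Var : Type) : Type
  | skip
  | seq (c c' : Cmd Qubit Var)
  | ite (e : Expr Var) (c1 c0 : Cmd Qubit Var)
  | whileC (e : Expr Var) (c : Cmd Qubit Var)
  | assign (x : Var) (e : Expr Var)
  | unitary (n : ℕ) (U : UnitaryOp n) (qs : Fin n → Qubit)
  | measure (x : Var) (k n : ℕ) (M : MeasOp k n) (qs : Fin n → Qubit)

/-! ## Behaviour trees (represented as partial labelling functions on paths) -/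

/-- Node labels of behaviour trees. -/
inductive BLabel (Qubit Var : Type) : Type
  | branch (k : ℕ)
  | leaf (a : Res Qubit Var ℕ)
  | nil

/-- Behaviour trees, represented by their partial labelling function on paths. -/
def BTree (Qubit Var : Type) : Type := List ℕ → Option (BLabel Qubit Var)

/-- The tree `Nil`. -/
def nilTree : BTree Qubit Var := fun p => if p = [] then some BLabel.nil else none

/-- The tree `Leaf a`. -/
def leafTree (a : Res Qubit Var ℕ) : BTree Qubit Var :=
  fun p => if p = [] then some (BLabel.leaf a) else none

/-- The tree `Branch` with `k` children. -/
def branchTree (k : ℕ) (child : Fin k → BTree Qubit Var) : BTree Qubit Var := fun p =>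
  match p with
  | [] => some (BLabel.branch k)
  | i :: p' => if h : i < k then child ⟨i, h⟩ p' else none

/-- Iterated child access `t.ī`. -/
def BTree.access (t : BTree Qubit Var) (is : List ℕ) : BTree Qubit Var :=
  fun p => t (is ++ p)

/-- Branching of partially-defined children: defined iff all children are. -/
def branchOpt (k : ℕ) (f : Fin k → Option (BTree Qubit Var)) : Option (BTree Qubit Var) :=
  if h : ∀ i, (f i).isSome then some (branchTree k (fun i => (f i).get (h i))) else none

/-- Store update. -/
def updStore (S : Store Var ℕ) (x : Var) (v : ℕ) : Store Var ℕ :=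
  fun y => if y = x then some v else S y

/-! ## Denotational semantics -/

/-- The `n`-th approximation of the denotational semantics, rendering
computations unfinished after `n` unfolding steps as `Nil`. -/
def semN : ℕ → List (Cmd Qubit Var) → QState Qubit → Store Var ℕ → Option (BTree Qubit Var)
  | 0, _, _, _ => some nilTree
  | _ + 1, [], ψ, S => some (leafTree (ψ, S))
  | n + 1, Cmd.skip :: cs, ψ, S => semN n cs ψ S
  | n + 1, Cmd.seq c c' :: cs, ψ, S => semN n (c :: c' :: cs) ψ S
  | n + 1, Cmd.ite e c1 c0 :: cs, ψ, S =>
      match Expr.eval S e with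
      | some 1 => semN n (c1 :: cs) ψ S
      | some 0 => semN n (c0 :: cs) ψ S
      | _ => none
  | n + 1, Cmd.whileC e c :: cs, ψ, S =>
      semN n (Cmd.ite e (Cmd.seq c (Cmd.whileC e c)) Cmd.skip :: cs) ψ S
  | n + 1, Cmd.assign x e :: cs, ψ, S =>
      match S x, Expr.eval S e with
      | some _, some v => semN n cs ψ (updStore S x v)
      | _, _ => none
  | n + 1, Cmd.unitary nq U qs :: cs, ψ, S =>
      match applyOp U.mat qs ψ with
      | some ψ' => semN n cs ψ' S
      | none => none
  | n + 1, Cmd.measure x k nq M qs :: cs, ψ, S =>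
      match S x with
      | some _ =>
          branchOpt k (fun i =>
            (applyOp (M.ops i) qs ψ).bind (fun ψ' => semN n cs ψ' (updStore S x i.1)))
      | none => none

/-- The denotational semantics: defined iff all approximations are, and then
the limit (least upper bound) of the ω-chain of approximations. -/
def sem (cs : List (Cmd Qubit Var)) (ψ : QState Qubit) (S : Store Var ℕ) :
    Option (BTree Qubit Var) :=
  if h : ∀ n, (semN n cs ψ S).isSome then
    some (fun p =>
      if h1 : ∃ n l, ((semN n cs ψ S).get (h n)) p = some l ∧ l ≠ BLabel.nil then
        some h1.choose_spec.choose
      else if ∃ n, ((semN n cs ψ S).get (h n)) p = some BLabel.nil then some BLabel.nil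
      else none)
  else none

/-! ## Logical semantics and Hoare triples -/

/-- The multiset of leaves of a behaviour tree, indexed by the branch paths. -/
def Leaves (t : BTree Qubit Var) : MSet (Res Qubit Var ℕ) :=
  MSet.mk { p : List ℕ // ∃ a, t p = some (BLabel.leaf a) } (fun p => p.2.choose)

/-- Logical semantics of a command on a multiset of resources. -/
def msem (C : Cmd Qubit Var) (m : MSet (Res Qubit Var ℕ)) :
    Option (MSet (Res Qubit Var ℕ)) :=
  if h : ∀ i, (sem [C] (m.out.val i).1 (m.out.val i).2).isSome then
    some (MSet.biguplus m.out.idx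
      (fun i => Leaves ((sem [C] (m.out.val i).1 (m.out.val i).2).get (h i))))
  else none

/-- The Hoare triple `{P} C {Q}`. -/
def hoare (P : SLProp Qubit Var ℕ) (C : Cmd Qubit Var) (Q : SLProp Qubit Var ℕ) : Prop :=
  ∀ m ∈ P, ∃ m', msem C m = some m' ∧ m' ∈ Q

/-- Logical semantics of a pure expression: extend the store of every outcome
with the binding of the distinguished variable `ret` to the value of `e`. -/
def esem (ret : Var) (e : Expr Var) (m : MSet (Res Qubit Var ℕ)) :
    Option (MSet (Res Qubit Var ℕ)) :=
  if h : ∀ i, (Expr.eval (m.out.val i).2 e).isSome then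
    some (MSet.mk m.out.idx (fun i =>
      ((m.out.val i).1,
        updStore (m.out.val i).2 ret ((Expr.eval (m.out.val i).2 e).get (h i)))))
  else none

/-- The Hoare triple `{P} e {Q}` for a pure expression. -/
def ehoare (ret : Var) (P : SLProp Qubit Var ℕ) (e : Expr Var)
    (Q : SLProp Qubit Var ℕ) : Prop :=
  ∀ m ∈ P, ∃ m', esem ret e m = some m' ∧ m' ∈ Q

/-- The return token `rtok v`. -/
def rtok (ret : Var) (v : ℕ) : SLProp Qubit Var ℕ := varPoints ret v


/-! ## Helpers -/

section Helpers

variable {Qb Vr : Type}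

def tens (ψ φ : QState Qb) : QState Qb := ⟨ψ.1 ∪ φ.1, tensorVec ψ.2 φ.2⟩

def su (S T : Store Vr ℕ) : Store Vr ℕ := fun x => S x <|> T x

def fr (b a : Res Qb Vr ℕ) : Res Qb Vr ℕ := (tens a.1 b.1, su a.2 b.2)

def Compat (a b : Res Qb Vr ℕ) : Prop :=
  Disjoint a.1.1 b.1.1 ∧ ∀ x, a.2 x = none ∨ b.2 x = none

theorem rmul_compat {a b : Res Qb Vr ℕ} (h : Compat a b) : rmul a b = some (fr b a) := by
  exact dif_pos h

theorem compat_of_isSome {a b : Res Qb Vr ℕ} (h : (rmul a b).isSome) : Compat a b := by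
  unfold rmul at h
  split_ifs at h with h'
  · exact h'
  · simp at h

theorem su_some {S T : Store Vr ℕ} {x : Vr} {v : ℕ} (h : S x = some v) :
    su S T x = some v := by
  simp [su, h]

theorem eval_su {S T : Store Vr ℕ} (e : Expr Vr) :
    ∀ {v : ℕ}, Expr.eval S e = some v → Expr.eval (su S T) e = some v := by
  induction e with
  | const n => intro v h; simpa [Expr.eval] using h
  | evar x => intro v h; simp only [Expr.eval] at h ⊢; exact su_some h
  | op n f es ih =>
    intro v h
    simp only [Expr.eval] at h ⊢
    split_ifs at h with h1
    have key : ∀ i, Expr.eval (su S T) (es i) = some ((Expr.eval S (es i)).get (h1 i)) :=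
      fun i => ih i (by simp)
    have h2 : ∀ i, (Expr.eval (su S T) (es i)).isSome := fun i => by rw [key i]; rfl
    rw [dif_pos h2, ← h]
    congr 2
    funext i
    simp [key i]

theorem upd_su {S T : Store Vr ℕ} (x : Vr) (v : ℕ) :
    su (updStore S x v) T = updStore (su S T) x v := by
  funext y
  by_cases h : y = x <;> simp [su, updStore, h]

theorem applyOp_tens {n : ℕ} {mat : (Fin n → Bool) → (Fin n → Bool) → ℂ} {qs : Fin n → Qb}
    {ψ φ ψ' : QState Qb} (hd : Disjoint ψ.1 φ.1) (h : applyOp mat qs ψ = some ψ') :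
    applyOp mat qs (tens ψ φ) = some (tens ψ' φ) ∧ ψ'.1 = ψ.1 := by
  unfold applyOp at h
  split_ifs at h with h1
  have h2 : Function.Injective qs ∧ ∀ i, qs i ∈ (tens ψ φ).1 :=
    ⟨h1.1, fun i => Finset.mem_union_left _ (h1.2 i)⟩
  cases h
  refine ⟨?_, rfl⟩
  unfold applyOp
  rw [dif_pos h2]
  unfold tens
  congr 2
  funext g
  simp only [tensorVec]
  rw [Finset.sum_mul]
  refine Finset.sum_congr rfl fun b _ => ?_
  rw [mul_assoc]
  congr 2
  refine congrArg φ.2 ?_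
  funext q
  refine dif_neg ?_
  rintro ⟨i, hi⟩
  exact Finset.disjoint_left.1 hd (h1.2 i) (hi ▸ q.2)

def mapL (b : Res Qb Vr ℕ) : BLabel Qb Vr → BLabel Qb Vr
  | .branch k => .branch k
  | .leaf a => .leaf (fr b a)
  | .nil => .nil

def mapT (b : Res Qb Vr ℕ) (t : BTree Qb Vr) : BTree Qb Vr := fun p => (t p).map (mapL b)

theorem mapT_nil (b : Res Qb Vr ℕ) : mapT b nilTree = nilTree := by
  funext p; by_cases h : p = [] <;> simp [mapT, nilTree, h, mapL]

theorem mapT_leaf (b a : Res Qb Vr ℕ) : mapT b (leafTree a) = leafTree (fr b a) := by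
  funext p; by_cases h : p = [] <;> simp [mapT, leafTree, h, mapL]

theorem mapT_branch (b : Res Qb Vr ℕ) (k : ℕ) (c : Fin k → BTree Qb Vr) :
    mapT b (branchTree k c) = branchTree k (fun i => mapT b (c i)) := by
  funext p
  cases p with
  | nil => simp [mapT, branchTree, mapL]
  | cons i p => by_cases h : i < k <;> simp [mapT, branchTree, h]

theorem branchOpt_some {k : ℕ} {f : Fin k → Option (BTree Qb Vr)} {t : BTree Qb Vr}
    (h : branchOpt k f = some t) :
    ∃ c, (∀ i, f i = some (c i)) ∧ t = branchTree k c := by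
  unfold branchOpt at h
  split_ifs at h with h1
  exact ⟨fun i => (f i).get (h1 i), fun i => by simp, by cases h; rfl⟩

theorem branchOpt_of {k : ℕ} {f : Fin k → Option (BTree Qb Vr)} {c : Fin k → BTree Qb Vr}
    (h : ∀ i, f i = some (c i)) : branchOpt k f = some (branchTree k c) := by
  have : f = fun i => some (c i) := funext h
  subst this
  exact dif_pos (fun i => rfl)

theorem compat_upd {ψ : QState Qb} {S : Store Vr ℕ} {b : Res Qb Vr ℕ} {x : Vr} {u v : ℕ}
    (h : Compat (ψ, S) b) (hx : S x = some u) : Compat (ψ, updStore S x v) b := by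
  refine ⟨h.1, fun y => ?_⟩
  by_cases hy : y = x
  · subst hy
    rcases h.2 y with h' | h'
    · simp [hx] at h'
    · exact Or.inr h'
  · simpa [updStore, hy] using h.2 y

theorem semN_frame (b : Res Qb Vr ℕ) : ∀ (n : ℕ) (cs : List (Cmd Qb Vr)) (ψ : QState Qb)
    (S : Store Vr ℕ) (t : BTree Qb Vr), Compat (ψ, S) b → semN n cs ψ S = some t →
    semN n cs (tens ψ b.1) (su S b.2) = some (mapT b t) ∧
      ∀ p a, t p = some (BLabel.leaf a) → Compat a b := by
  intro n
  induction n with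
  | zero =>
    intro cs ψ S t hc h
    simp only [semN, Option.some.injEq] at h ⊢
    subst h
    refine ⟨(mapT_nil b).symm, fun p a hp => ?_⟩
    unfold nilTree at hp
    split_ifs at hp
    cases hp
  | succ n ih =>
    intro cs ψ S t hc h
    cases cs with
    | nil =>
      simp only [semN, Option.some.injEq] at h ⊢
      subst h
      refine ⟨(mapT_leaf b (ψ, S)).symm, fun p a hp => ?_⟩
      unfold leafTree at hp
      split_ifs at hp
      cases hp
      exact hc
    | cons c cs =>
      cases c with
      | skip => simp only [semN] at h ⊢; exact ih _ _ _ _ hc h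
      | seq c c' => simp only [semN] at h ⊢; exact ih _ _ _ _ hc h
      | whileC e c => simp only [semN] at h ⊢; exact ih _ _ _ _ hc h
      | ite e c1 c0 =>
        simp only [semN] at h ⊢
        split at h
        · next he => rw [eval_su e he]; exact ih _ _ _ _ hc h
        · next he => rw [eval_su e he]; exact ih _ _ _ _ hc h
        · cases h
      | assign x e =>
        simp only [semN] at h ⊢
        split at h
        · next u v hx he =>
          rw [eval_su e he, su_some hx]
          have := ih _ _ _ _ (compat_upd hc hx) h
          rw [upd_su] at this
          exact this
        · cases h
      | unitary nq U qs =>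
        simp only [semN] at h ⊢
        split at h
        · next ψ' hψ =>
          obtain ⟨h1, h2⟩ := applyOp_tens (φ := b.1) hc.1 hψ
          rw [h1]
          exact ih _ _ _ _ ⟨by simpa [h2] using hc.1, hc.2⟩ h
        · cases h
      | measure x k nq M qs =>
        simp only [semN] at h ⊢
        split at h
        · next u hx =>
          rw [su_some hx]
          obtain ⟨c, hcs, rfl⟩ := branchOpt_some h
          have key : ∀ i : Fin k,
              ((applyOp (M.ops i) qs (tens ψ b.1)).bind (fun ψ' => semN n cs ψ'
                (updStore (su S b.2) x i.1))) = some (mapT b (c i)) ∧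
              ∀ p a, c i p = some (BLabel.leaf a) → Compat a b := by
            intro i
            obtain ⟨ψ', hψ, hs⟩ := Option.bind_eq_some_iff.1 (hcs i)
            obtain ⟨h1, h2⟩ := applyOp_tens (φ := b.1) hc.1 hψ
            have hc' : Compat (ψ', updStore S x i.1) b :=
              ⟨by simpa [h2] using hc.1, (compat_upd hc hx).2⟩
            have := ih _ _ _ _ hc' hs
            rw [upd_su] at this
            rw [h1]
            exact this
          refine ⟨?_, ?_⟩
          · rw [mapT_branch]
            exact branchOpt_of fun i => (key i).1
          · intro p a hp
            cases p with
            | nil => simp [branchTree] at hp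
            | cons i p =>
              simp only [branchTree] at hp
              split_ifs at hp with hi
              exact (key ⟨i, hi⟩).2 p a hp
        · cases h

/-- Limit of a family of trees, as in `sem`. -/
def limT (T : ℕ → BTree Qb Vr) : BTree Qb Vr := fun p =>
  if h1 : ∃ n l, T n p = some l ∧ l ≠ BLabel.nil then
    some h1.choose_spec.choose
  else if ∃ n, T n p = some BLabel.nil then some BLabel.nil
  else none

theorem sem_of {cs : List (Cmd Qb Vr)} {ψ : QState Qb} {S : Store Vr ℕ} {T : ℕ → BTree Qb Vr}
    (h : ∀ n, semN n cs ψ S = some (T n)) : sem cs ψ S = some (limT T) := by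
  have h' : ∀ n, (semN n cs ψ S).isSome := fun n => by rw [h n]; rfl
  have e : T = fun n => (semN n cs ψ S).get (h' n) := by
    funext n; simp [h n]
  unfold sem
  rw [dif_pos h', e]
  rfl

theorem sem_some {cs : List (Cmd Qb Vr)} {ψ : QState Qb} {S : Store Vr ℕ} {t : BTree Qb Vr}
    (h : sem cs ψ S = some t) : ∃ T, (∀ n, semN n cs ψ S = some (T n)) ∧ t = limT T := by
  have h' : ∀ n, (semN n cs ψ S).isSome := by
    unfold sem at h
    split_ifs at h with h'
    exact h'
  refine ⟨fun n => (semN n cs ψ S).get (h' n), fun n => by simp, ?_⟩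
  have := sem_of (cs := cs) (ψ := ψ) (S := S) (T := fun n => (semN n cs ψ S).get (h' n)) (fun n => by simp)
  rw [h] at this
  exact Option.some.inj this

theorem mapL_nil {b : Res Qb Vr ℕ} {l : BLabel Qb Vr} : mapL b l = .nil ↔ l = .nil := by
  cases l <;> simp [mapL]

theorem limT_map (b : Res Qb Vr ℕ) (T : ℕ → BTree Qb Vr) :
    limT (fun n => mapT b (T n)) = mapT b (limT T) := by
  funext p
  have hp : (fun n => ∃ l, mapT b (T n) p = some l ∧ l ≠ BLabel.nil) =
      (fun n => ∃ l, T n p = some l ∧ l ≠ BLabel.nil) := by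
    funext n
    apply propext
    constructor
    · rintro ⟨l, h1, h2⟩
      obtain ⟨l', h3, h4⟩ := Option.map_eq_some_iff.1 h1
      exact ⟨l', h3, fun h => h2 (by rw [← h4, h]; rfl)⟩
    · rintro ⟨l, h1, h2⟩
      exact ⟨mapL b l, by simp [mapT, h1], fun h => h2 (mapL_nil.1 h)⟩
  have hq : (∃ n, mapT b (T n) p = some BLabel.nil) ↔ ∃ n, T n p = some BLabel.nil := by
    refine exists_congr fun n => ?_
    simp only [mapT, Option.map_eq_some_iff, mapL_nil]
    simp
  have main : ∀ (A B : ℕ → Prop) (hAB : A = B) (hA : ∃ n, A n) (hB : ∃ n, B n),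
      hA.choose = hB.choose := by
    intro A B hAB hA hB; subst hAB; rfl
  by_cases h1 : ∃ n l, T n p = some l ∧ l ≠ BLabel.nil
  · have h2 : ∃ n l, mapT b (T n) p = some l ∧ l ≠ BLabel.nil := by
      have h3 := h1
      change ∃ n, (fun n => ∃ l, T n p = some l ∧ l ≠ BLabel.nil) n at h3
      rw [← hp] at h3
      exact h3
    have e1 : limT T p = some h1.choose_spec.choose := by unfold limT; rw [dif_pos h1]
    have e2 : limT (fun n => mapT b (T n)) p = some h2.choose_spec.choose := by
      unfold limT; rw [dif_pos h2]
    have s1 := h1.choose_spec.choose_spec.1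
    have s2 := h2.choose_spec.choose_spec.1
    have e3 : h2.choose = h1.choose := main _ _ hp h2 h1
    generalize h2.choose_spec.choose = l2 at e2 s2
    generalize h1.choose_spec.choose = l1 at e1 s1
    rw [e3] at s2
    refine (e2.trans s2.symm).trans ?_
    exact congrArg (Option.map (mapL b)) (s1.trans e1.symm)
  · have h2 : ¬ ∃ n l, mapT b (T n) p = some l ∧ l ≠ BLabel.nil := by
      intro h2
      change ∃ n, (fun n => ∃ l, mapT b (T n) p = some l ∧ l ≠ BLabel.nil) n at h2
      rw [hp] at h2
      exact h1 h2
    have e1 : limT T p = if ∃ n, T n p = some BLabel.nil then some BLabel.nil else none := by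
      unfold limT; rw [dif_neg h1]
    have e2 : limT (fun n => mapT b (T n)) p =
        if ∃ n, T n p = some BLabel.nil then some BLabel.nil else none := by
      unfold limT; rw [dif_neg h2]; simp only [hq]
    refine e2.trans (Eq.trans ?_ (congrArg (Option.map (mapL b)) e1.symm))
    split_ifs <;> rfl

theorem limT_mem {T : ℕ → BTree Qb Vr} {p : List ℕ} {a : Res Qb Vr ℕ}
    (h : limT T p = some (.leaf a)) : ∃ n, T n p = some (.leaf a) := by
  unfold limT at h
  split_ifs at h with h1 h2
  · have := h1.choose_spec.choose_spec.1
    rw [Option.some.inj h] at this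
    exact ⟨_, this⟩
  · cases h

theorem sem_frame {b a : Res Qb Vr ℕ} {cs : List (Cmd Qb Vr)} {t : BTree Qb Vr}
    (hc : Compat a b) (h : sem cs a.1 a.2 = some t) :
    sem cs (fr b a).1 (fr b a).2 = some (mapT b t) ∧
      ∀ p c, t p = some (BLabel.leaf c) → Compat c b := by
  obtain ⟨T, hT, rfl⟩ := sem_some h
  have k := fun n => semN_frame b n cs a.1 a.2 (T n) hc (hT n)
  refine ⟨?_, fun p c hp => ?_⟩
  · rw [← limT_map]
    exact sem_of fun n => (k n).1
  · obtain ⟨n, hn⟩ := limT_mem hp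
    exact (k n).2 p c hn

/-! Multiset lemmas. -/

theorem mk_eq {A I J : Type} {f : I → A} {g : J → A} (e : I ≃ J) (h : ∀ i, f i = g (e i)) :
    MSet.mk I f = MSet.mk J g := Quotient.sound ⟨e, h⟩

theorem out_mk {A I : Type} (f : I → A) :
    ∃ e : (MSet.mk I f).out.idx ≃ I, ∀ i, (MSet.mk I f).out.val i = f (e i) :=
  Quotient.exact (Quotient.out_eq (MSet.mk I f))

theorem exists_mk {A : Type} (m : MSet A) : ∃ (I : Type) (f : I → A), m = MSet.mk I f := by
  induction m using Quotient.inductionOn with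
  | _ p => exact ⟨p.idx, p.val, rfl⟩

theorem biguplus_mk {A I I' : Type} {J : I' → Type} (f : ∀ i, J i → A) (e : I ≃ I') :
    MSet.biguplus I (fun i => MSet.mk (J (e i)) (f (e i))) =
      MSet.mk (Σ i, J i) (fun p => f p.1 p.2) := by
  choose E hE using fun i => out_mk (f (e i))
  refine mk_eq ((Equiv.sigmaCongrRight E).trans (Equiv.sigmaCongrLeft (β := J) e)) ?_
  rintro ⟨i, j⟩
  exact hE i j

theorem mprod_of {I J : Type} {f : I → Res Qb Vr ℕ} {g : J → Res Qb Vr ℕ}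
    (h : ∀ i j, Compat (f i) (g j)) :
    mprodM (MSet.mk I f) (MSet.mk J g) =
      some (MSet.mk (I × J) (fun p => fr (g p.2) (f p.1))) := by
  obtain ⟨e, he⟩ := out_mk f
  obtain ⟨e', he'⟩ := out_mk g
  have key : ∀ i j, rmul ((MSet.mk I f).out.val i) ((MSet.mk J g).out.val j) =
      some (fr (g (e' j)) (f (e i))) := fun i j => by
    rw [he, he']; exact rmul_compat (h _ _)
  unfold mprodM
  rw [dif_pos (fun i j => by rw [key i j]; rfl)]
  congr 1
  refine mk_eq (e.prodCongr e') ?_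
  rintro ⟨i, j⟩
  simp [key i j]

theorem mprod_some {I J : Type} {f : I → Res Qb Vr ℕ} {g : J → Res Qb Vr ℕ}
    {m : MSet (Res Qb Vr ℕ)} (h : mprodM (MSet.mk I f) (MSet.mk J g) = some m) :
    ∀ i j, Compat (f i) (g j) := by
  obtain ⟨e, he⟩ := out_mk f
  obtain ⟨e', he'⟩ := out_mk g
  unfold mprodM at h
  split_ifs at h with h1
  intro i j
  have := h1 (e.symm i) (e'.symm j)
  rw [he, he'] at this
  simpa using compat_of_isSome this

def LI (t : BTree Qb Vr) : Type := { p : List ℕ // ∃ a, t p = some (BLabel.leaf a) }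

def lv (t : BTree Qb Vr) (p : LI t) : Res Qb Vr ℕ := p.2.choose

theorem lv_spec (t : BTree Qb Vr) (p : LI t) : t p.1 = some (.leaf (lv t p)) := p.2.choose_spec

theorem msem_of {C : Cmd Qb Vr} {I : Type} {f : I → Res Qb Vr ℕ} {t : I → BTree Qb Vr}
    (h : ∀ i, sem [C] (f i).1 (f i).2 = some (t i)) :
    msem C (MSet.mk I f) = some (MSet.mk (Σ i, LI (t i)) (fun p => lv (t p.1) p.2)) := by
  obtain ⟨e, he⟩ := out_mk f
  have key : ∀ i, sem [C] ((MSet.mk I f).out.val i).1 ((MSet.mk I f).out.val i).2 =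
      some (t (e i)) := fun i => by rw [he]; exact h _
  unfold msem
  rw [dif_pos (fun i => by rw [key i]; rfl)]
  congr 1
  rw [← biguplus_mk (J := fun i => LI (t i)) (fun i => lv (t i)) e]
  congr 1
  funext i
  simp only [key i, Option.get_some]
  rfl

theorem msem_some {C : Cmd Qb Vr} {I : Type} {f : I → Res Qb Vr ℕ} {m : MSet (Res Qb Vr ℕ)}
    (h : msem C (MSet.mk I f) = some m) :
    ∃ t : I → BTree Qb Vr, ∀ i, sem [C] (f i).1 (f i).2 = some (t i) := by
  obtain ⟨e, he⟩ := out_mk f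
  unfold msem at h
  split_ifs at h with h1
  have : ∀ i, ∃ t, sem [C] (f i).1 (f i).2 = some t := by
    intro i
    have := h1 (e.symm i)
    rw [he] at this
    simp only [Equiv.apply_symm_apply] at this
    exact Option.isSome_iff_exists.1 this
  choose t ht using this
  exact ⟨t, ht⟩

theorem mapT_leaf_iff {b : Res Qb Vr ℕ} {t : BTree Qb Vr} {p : List ℕ} :
    (∃ a, mapT b t p = some (BLabel.leaf a)) ↔ ∃ a, t p = some (BLabel.leaf a) := by
  constructor
  · rintro ⟨a, h⟩
    obtain ⟨l, h1, h2⟩ := Option.map_eq_some_iff.1 h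
    cases l with
    | leaf c => exact ⟨c, h1⟩
    | branch k => simp [mapL] at h2
    | nil => simp [mapL] at h2
  · rintro ⟨a, h⟩
    exact ⟨fr b a, by simp [mapT, h, mapL]⟩

def LIequiv (b : Res Qb Vr ℕ) (t : BTree Qb Vr) : LI (mapT b t) ≃ LI t :=
  Equiv.subtypeEquivRight fun _ => mapT_leaf_iff

theorem lv_mapT (b : Res Qb Vr ℕ) (t : BTree Qb Vr) (p : LI (mapT b t)) :
    lv (mapT b t) p = fr b (lv t (LIequiv b t p)) := by
  have h1 := lv_spec _ p
  have h2 : t p.1 = _ := lv_spec t (LIequiv b t p)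
  unfold mapT at h1
  rw [h2] at h1
  simp only [Option.map_some, mapL, Option.some.injEq, BLabel.leaf.injEq] at h1
  exact h1.symm

end Helpers

/-- Soundness of the frame rule: no side conditions are required. -/
theorem hoare_frame {Qubit Var : Type} (C : Cmd Qubit Var)
    (P Q R : SLProp Qubit Var ℕ) (h : hoare P C Q) :
    hoare (star P R) C (star Q R) := by
  rintro m ⟨mp, hmp, mr, hmr, hm⟩
  obtain ⟨I, f, rfl⟩ := exists_mk mp
  obtain ⟨J, g, rfl⟩ := exists_mk mr
  have hc := mprod_some hm
  rw [mprod_of hc] at hm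
  cases hm
  obtain ⟨m1, h1, hm1⟩ := h _ hmp
  obtain ⟨t, ht⟩ := msem_some h1
  rw [msem_of ht] at h1
  cases h1
  have k := fun (p : I × J) => sem_frame (hc p.1 p.2) (ht p.1)
  refine ⟨_, msem_of (t := fun p : I × J => mapT (g p.2) (t p.1)) (fun p => (k p).1), ?_⟩
  refine ⟨_, hm1, _, hmr, ?_⟩
  rw [mprod_of]
  · congr 1
    symm
    refine mk_eq
      { toFun := fun x => (⟨x.1.1, LIequiv _ _ x.2⟩, x.1.2)
        invFun := fun y => ⟨(y.1.1, y.2), (LIequiv (g y.2) (t y.1.1)).symm y.1.2⟩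
        left_inv := fun x => by simp
        right_inv := fun y => by simp } ?_
    rintro ⟨p, x⟩
    exact lv_mapT _ _ _
  · rintro ⟨i, x⟩ j
    exact (k (i, j)).2 _ _ (lv_spec (t i) x)
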